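/- arXiv:2509.05699 — 13 statements merged into one kernel-verified Lean document; each statement's English description precedes it below -/
import Mathlib

section
/- Let E be a θ-prime ideal of R. Then the radical rad(E) of E is also a θ-prime ideal of R. -/
/-- A proper ideal `E` of a commutative ring `R` is `θ`-prime (Endo-prime associated
with the endomorphism `θ`) if `u * v ∈ E` implies `u ∈ E` or `θ v ∈ E`. -/
def IsEndoPrime {R : Type*} [CommRing R] (θ : R →+* R) (E : Ideal R) : Prop :=
  E ≠ ⊤ ∧ ∀ u v : R, u * v ∈ E → u ∈ E ∨ θ v ∈ E

theorem radical_isEndoPrime {R : Type*} [CommRing R] (θ : R →+* R) (E : Ideal R)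
    (hE : IsEndoPrime θ E) : IsEndoPrime θ E.radical := by
  refine ⟨fun h => hE.1 (Ideal.radical_eq_top.mp h), ?_⟩
  rintro u v ⟨r, hr⟩
  rw [mul_pow] at hr
  refine (hE.2 _ _ hr).imp (fun h => ⟨r, h⟩) fun h => ⟨r, ?_⟩
  rwa [← map_pow]
end

section
/- Let E be a θ-prime ideal of R and let A be a subset of R such that the colon ideal (E : A) = {v ∈ R : av ∈ E for all a ∈ A} is a proper ideal of R. Then (E : A) is a θ-prime ideal of R. -/
/-- The colon ideal `(E : A) = {v : R | ∀ a ∈ A, a * v ∈ E}` of an ideal `E`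
with respect to a subset `A` of `R`. -/
def colonSet {R : Type*} [CommRing R] (E : Ideal R) (A : Set R) : Ideal R where
  carrier := {v : R | ∀ a ∈ A, a * v ∈ E}
  zero_mem' := fun a _ => by simp
  add_mem' := fun hu hv a ha => by
    simpa [mul_add] using E.add_mem (hu a ha) (hv a ha)
  smul_mem' := fun c v hv a ha => by
    simpa [smul_eq_mul, mul_left_comm] using E.mul_mem_left c (hv a ha)

theorem colonSet_isEndoPrime {R : Type*} [CommRing R] (θ : R →+* R) (E : Ideal R)
    (A : Set R) (hE : IsEndoPrime θ E) (hproper : colonSet E A ≠ ⊤) :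
    IsEndoPrime θ (colonSet E A) := by
  refine ⟨hproper, fun u v huv => ?_⟩
  by_cases hv : θ v ∈ E
  · exact Or.inr fun a _ => E.mul_mem_left a hv
  · refine Or.inl fun a ha => (hE.2 (a * u) v ?_).resolve_right hv
    rw [mul_assoc]
    exact huv a ha
end

section
/- Let E be a θ-prime ideal of R. If u ∈ R and u^r ∈ E for some positive integer r, then θ(u) ∈ E. -/
theorem theta_mem_of_pow_mem {R : Type*} [CommRing R] (θ : R →+* R) (E : Ideal R)
    (hE : IsEndoPrime θ E) (u : R) (r : ℕ) (hr : 0 < r) (h : u ^ r ∈ E) : θ u ∈ E := by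
  clear hr
  induction r with
  | zero => exact absurd ((Ideal.eq_top_iff_one E).2 (pow_zero u ▸ h)) hE.1
  | succ k ih => exact (hE.2 (u ^ k) u (pow_succ u k ▸ h)).elim ih id
end

section
/- Let E be a proper ideal of R. The following statements are equivalent: (1) E is a θ-prime ideal; (2) for every u ∈ R, either the principal ideal generated by u is contained in E, or θ((E : u)) ⊆ E; (3) for all ideals I and J of R, IJ ⊆ E implies I ⊆ E or θ(J) ⊆ E; (4) E = (E : v) for every v ∈ R with θ(v) ∉ E. -/
theorem isEndoPrime_tfae {R : Type*} [CommRing R] (θ : R →+* R) (E : Ideal R)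
    (hE : E ≠ ⊤) :
    List.TFAE
      [ IsEndoPrime θ E,
        ∀ u : R, Ideal.span {u} ≤ E ∨ ∀ v : R, u * v ∈ E → θ v ∈ E,
        ∀ I J : Ideal R, I * J ≤ E → I ≤ E ∨ ∀ v ∈ J, θ v ∈ E,
        ∀ v : R, θ v ∉ E → ∀ u : R, u ∈ E ↔ v * u ∈ E ] := by
  tfae_have 1 → 2 := by
    rintro ⟨-, h⟩ u
    by_cases hu : u ∈ E
    · exact .inl ((Ideal.span_singleton_le_iff_mem E).2 hu)
    · exact .inr fun v huv => (h u v huv).resolve_left hu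
  tfae_have 2 → 3 := by
    intro h I J hIJ
    refine or_iff_not_imp_left.2 fun hI v hv => ?_
    obtain ⟨u, hu, huE⟩ := SetLike.not_le_iff_exists.1 hI
    rw [← Ideal.span_singleton_le_iff_mem] at huE
    exact (h u).resolve_left huE v (hIJ (Ideal.mul_mem_mul hu hv))
  tfae_have 3 → 1 := by
    refine fun h => ⟨hE, fun u v huv => ?_⟩
    have hspan : Ideal.span {u} * Ideal.span {v} ≤ E := by
      rwa [Ideal.span_singleton_mul_span_singleton, Ideal.span_singleton_le_iff_mem]
    exact (h _ _ hspan).imp (Ideal.span_singleton_le_iff_mem E).1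
      fun hJ => hJ v (Ideal.mem_span_singleton_self v)
  tfae_have 1 → 4 := by
    rintro ⟨-, h⟩ v hv u
    exact ⟨E.mul_mem_left v, fun hvu => (h u v (mul_comm v u ▸ hvu)).resolve_right hv⟩
  tfae_have 4 → 1 := by
    refine fun h => ⟨hE, fun u v huv => or_iff_not_imp_right.2 fun hv => ?_⟩
    exact (h v hv u).2 (mul_comm u v ▸ huv)
  tfae_finish
end

section
/- Let {E_j}_{j ∈ ω} be a nonempty family of ideals of R that forms a chain under inclusion (i.e., for all a, b ∈ ω, E_a ⊆ E_b or E_b ⊆ E_a). If every E_j is a θ-prime ideal of R, then the intersection ⋂_{j ∈ ω} E_j is a θ-prime ideal of R. -/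
theorem iInf_chain_isEndoPrime {R : Type*} [CommRing R] (θ : R →+* R)
    {ι : Type*} [Nonempty ι] (E : ι → Ideal R)
    (hchain : ∀ a b : ι, E a ≤ E b ∨ E b ≤ E a)
    (h : ∀ j : ι, IsEndoPrime θ (E j)) : IsEndoPrime θ (⨅ j, E j) := by
  refine ⟨fun htop => ?_, fun u v huv => ?_⟩
  · obtain ⟨j⟩ := ‹Nonempty ι›
    exact (h j).1 (iInf_eq_top.mp htop j)
  · simp only [Ideal.mem_iInf] at huv ⊢
    by_contra! hne
    obtain ⟨⟨a, ha⟩, b, hb⟩ := hne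
    have hva : θ v ∈ E a := ((h a).2 u v (huv a)).resolve_left ha
    have hub : u ∈ E b := ((h b).2 u v (huv b)).resolve_right hb
    rcases hchain a b with hab | hba
    · exact hb (hab hva)
    · exact ha (hba hub)
end

section
/- Let E be a θ-prime ideal of R and let Q be a prime ideal of R that is minimal over E (i.e., Q contains E and Q is minimal among the prime ideals of R containing E). Then θ(Q) ⊆ E. -/
theorem image_minimal_prime_subset {R : Type*} [CommRing R] (θ : R →+* R)
    (E Q : Ideal R) (hE : IsEndoPrime θ E) (hQ : Q.IsPrime) (hEQ : E ≤ Q)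
    (hmin : ∀ P : Ideal R, P.IsPrime → E ≤ P → P ≤ Q → P = Q) :
    ∀ u ∈ Q, θ u ∈ E := by
  intro u hu
  have hQmin : Q ∈ E.minimalPrimes :=
    ⟨⟨hQ, hEQ⟩, fun P hP hPQ => (hmin P hP.1 hP.2 hPQ).ge⟩
  obtain ⟨v, hv, huv⟩ := Ideal.exists_mul_mem_of_mem_minimalPrimes hQmin hu
  exact (hE.2 v u (mul_comm u v ▸ huv)).resolve_left hv
end

section
/- If E is a θ-prime ideal of R, then θ(rad(E)) ⊆ E, i.e., θ(u) ∈ E for every u in the radical of E. -/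
theorem image_radical_subset {R : Type*} [CommRing R] (θ : R →+* R) (E : Ideal R)
    (hE : IsEndoPrime θ E) : ∀ u ∈ E.radical, θ u ∈ E := by
  rintro u ⟨n, hn⟩
  induction n with
  | zero => exact absurd ((Ideal.eq_top_iff_one E).2 (by simpa using hn)) hE.1
  | succ n ih => exact (hE.2 (u ^ n) u (by rwa [← pow_succ])).elim ih id
end

section
/- Let E be a proper ideal of R with θ(E) ⊆ E, and let θ_E : R/E → R/E be the ring endomorphism induced by θ on the quotient ring, given by θ_E(u + E) = θ(u) + E. Then: (1) if E is strongly θ-prime (i.e., for all ideals I, J of R, IJ ⊆ E implies I ⊆ E or θ(J) ⊆ E), then R/E is a θ_E-integral domain, meaning that for all x, y ∈ R/E, xy = 0 implies x = 0 or θ_E(y) = 0; (2) conversely, if R/E is a θ_E-integral domain, then E is a θ-prime ideal of R. -/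
theorem strongly_endoPrime_quotient {R : Type*} [CommRing R] (θ : R →+* R)
    (E : Ideal R) (hE : E ≠ ⊤) (hEθ : E ≤ E.comap θ) :
    ((∀ I J : Ideal R, I * J ≤ E → I ≤ E ∨ ∀ v ∈ J, θ v ∈ E) →
      ∀ x y : R ⧸ E, x * y = 0 → x = 0 ∨ Ideal.quotientMap E θ hEθ y = 0) ∧
    ((∀ x y : R ⧸ E, x * y = 0 → x = 0 ∨ Ideal.quotientMap E θ hEθ y = 0) →
      IsEndoPrime θ E) := by
  constructor
  · intro h x y hxy
    obtain ⟨u, rfl⟩ := Ideal.Quotient.mk_surjective x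
    obtain ⟨v, rfl⟩ := Ideal.Quotient.mk_surjective y
    rw [← map_mul, Ideal.Quotient.eq_zero_iff_mem] at hxy
    rw [Ideal.quotientMap_mk, Ideal.Quotient.eq_zero_iff_mem, Ideal.Quotient.eq_zero_iff_mem]
    have hle : Ideal.span {u} * Ideal.span {v} ≤ E := by
      rwa [Ideal.span_singleton_mul_span_singleton, Ideal.span_singleton_le_iff_mem]
    exact (h _ _ hle).imp (Ideal.span_singleton_le_iff_mem E).mp
      fun hJ => hJ v (Ideal.mem_span_singleton_self v)
  · intro h
    refine ⟨hE, fun u v huv => ?_⟩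
    have := h (Ideal.Quotient.mk E u) (Ideal.Quotient.mk E v)
      (by rwa [← map_mul, Ideal.Quotient.eq_zero_iff_mem])
    rwa [Ideal.quotientMap_mk, Ideal.Quotient.eq_zero_iff_mem,
      Ideal.Quotient.eq_zero_iff_mem] at this
end

section
/- Let η : R₁ → R₂ be a surjective ring homomorphism between commutative rings with identity, and let θ₁ : R₁ → R₁ and θ₂ : R₂ → R₂ be ring endomorphisms such that θ₂ ∘ η = η ∘ θ₁. If E₁ is a θ₁-prime ideal of R₁ with ker η ⊆ E₁, then the image η(E₁) is a θ₂-prime ideal of R₂. -/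
theorem map_isEndoPrime_of_commutes {R₁ R₂ : Type*} [CommRing R₁] [CommRing R₂]
    (η : R₁ →+* R₂) (hsurj : Function.Surjective η)
    (θ₁ : R₁ →+* R₁) (θ₂ : R₂ →+* R₂)
    (hcomm : ∀ x : R₁, θ₂ (η x) = η (θ₁ x))
    (E₁ : Ideal R₁) (hE₁ : IsEndoPrime θ₁ E₁)
    (hker : RingHom.ker η ≤ E₁) :
    IsEndoPrime θ₂ (E₁.map η) := by
  have hmem (x : R₁) : η x ∈ E₁.map η ↔ x ∈ E₁ := by
    rw [← Ideal.mem_comap, Ideal.comap_map_of_surjective' η hsurj, sup_eq_left.mpr hker]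
  refine ⟨fun h => hE₁.1 ?_, fun u v huv => ?_⟩
  · rw [Ideal.eq_top_iff_one, ← hmem, h]
    exact Submodule.mem_top
  · obtain ⟨a, rfl⟩ := hsurj u
    obtain ⟨b, rfl⟩ := hsurj v
    rw [← map_mul, hmem] at huv
    rw [hcomm, hmem, hmem]
    exact hE₁.2 a b huv
end

section
/- Let S be a multiplicative submonoid of R containing 1 with θ(S) ⊆ S, and let θ̄ : S⁻¹R → S⁻¹R be the induced ring endomorphism of the localization of R at S, defined by θ̄(u/s) = θ(u)/θ(s). If E is a θ-prime ideal of R with E ∩ S = ∅, then the extension S⁻¹E of E to S⁻¹R is a θ̄-prime ideal of S⁻¹R. -/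
theorem localization_isEndoPrime {R : Type*} [CommRing R] (θ : R →+* R)
    (S : Submonoid R) (hS : ∀ s ∈ S, θ s ∈ S)
    (θbar : Localization S →+* Localization S)
    (hθbar : ∀ (u : R) (s : S),
      θbar (Localization.mk u s) = Localization.mk (θ u) ⟨θ s, hS s s.2⟩)
    (E : Ideal R) (hE : IsEndoPrime θ E)
    (hdisj : ∀ s ∈ S, s ∉ E) :
    IsEndoPrime θbar (E.map (algebraMap R (Localization S))) := by
  have hmk (x : R) (s : S) : Localization.mk x s ∈ E.map (algebraMap R (Localization S)) ↔
      ∃ c ∈ S, c * x ∈ E := by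
    rw [Localization.mk_eq_mk', IsLocalization.mk'_mem_map_algebraMap_iff]
  refine ⟨fun h => ?_, fun a b hab => ?_⟩
  · have h1 : Localization.mk (1 : R) (1 : S) ∈ E.map (algebraMap R (Localization S)) :=
      h ▸ Submodule.mem_top
    obtain ⟨c, hc, hcE⟩ := (hmk 1 1).1 h1
    exact hdisj c hc (by simpa using hcE)
  · induction a using Localization.induction_on with | H p => ?_
    induction b using Localization.induction_on with | H q => ?_
    obtain ⟨u, s⟩ := p
    obtain ⟨v, t⟩ := q
    rw [Localization.mk_mul, hmk] at hab
    obtain ⟨c, hc, hcE⟩ := hab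
    rw [hθbar, hmk, hmk]
    have huv : u * v ∈ E :=
      (hE.2 (u * v) c (by rwa [mul_comm])).resolve_right (hdisj _ (hS c hc))
    exact (hE.2 u v huv).imp (fun h => ⟨1, S.one_mem, by rwa [one_mul]⟩)
      (fun h => ⟨1, S.one_mem, by rwa [one_mul]⟩)
end

section
/- Let S be a multiplicative submonoid of R containing 1 with θ(S) ⊆ S, and let θ̄ : S⁻¹R → S⁻¹R be the induced ring endomorphism of the localization of R at S, defined by θ̄(u/s) = θ(u)/θ(s). If F is a θ̄-prime ideal of S⁻¹R, then the preimage of F under the canonical map R → S⁻¹R is a θ-prime ideal of R. -/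
theorem comap_localization_isEndoPrime {R : Type*} [CommRing R] (θ : R →+* R)
    (S : Submonoid R) (hS : ∀ s ∈ S, θ s ∈ S)
    (θbar : Localization S →+* Localization S)
    (hθbar : ∀ (u : R) (s : S),
      θbar (Localization.mk u s) = Localization.mk (θ u) ⟨θ s, hS s s.2⟩)
    (F : Ideal (Localization S)) (hF : IsEndoPrime θbar F) :
    IsEndoPrime θ (F.comap (algebraMap R (Localization S))) := by
  have hmap : ∀ v : R, θbar (algebraMap R (Localization S) v) =
      algebraMap R (Localization S) (θ v) := fun v => by
    rw [← Localization.mk_one_eq_algebraMap, ← Localization.mk_one_eq_algebraMap, hθbar]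
    congr 1
    exact Subtype.ext (map_one θ)
  refine ⟨Ideal.comap_ne_top _ hF.1, fun u v huv => ?_⟩
  rw [Ideal.mem_comap, map_mul] at huv
  simpa only [Ideal.mem_comap, hmap] using hF.2 _ _ huv
end

section
/- Let R₁ and R₂ be commutative rings with identity, θ₁ : R₁ → R₁ and θ₂ : R₂ → R₂ ring endomorphisms, and let θ₁ × θ₂ denote the induced endomorphism of the product ring R₁ × R₂. For an ideal E of R₁ × R₂, the following are equivalent: (1) E is a (θ₁ × θ₂)-prime ideal of R₁ × R₂; (2) either E = E₁ × R₂ for some θ₁-prime ideal E₁ of R₁, or E = R₁ × E₂ for some θ₂-prime ideal E₂ of R₂. -/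
theorem isEndoPrime_prod_top_iff {R₁ R₂ : Type*} [CommRing R₁] [CommRing R₂]
    (θ₁ : R₁ →+* R₁) (θ₂ : R₂ →+* R₂) (I : Ideal R₁) :
    IsEndoPrime (θ₁.prodMap θ₂) (Ideal.prod I (⊤ : Ideal R₂)) ↔ IsEndoPrime θ₁ I := by
  simp only [IsEndoPrime, Ne, Ideal.eq_top_iff_one, Ideal.mem_prod, Prod.forall]
  simp only [Prod.fst_one, Submodule.mem_top, and_true, Prod.mk_mul_mk, RingHom.coe_prodMap,
    Prod.map_apply]
  exact and_congr_right fun _ => ⟨fun h u v => h u 0 v 0, fun h u _ v _ => h u v⟩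

theorem isEndoPrime_top_prod_iff {R₁ R₂ : Type*} [CommRing R₁] [CommRing R₂]
    (θ₁ : R₁ →+* R₁) (θ₂ : R₂ →+* R₂) (J : Ideal R₂) :
    IsEndoPrime (θ₁.prodMap θ₂) (Ideal.prod (⊤ : Ideal R₁) J) ↔ IsEndoPrime θ₂ J := by
  simp only [IsEndoPrime, Ne, Ideal.eq_top_iff_one, Ideal.mem_prod, Prod.forall]
  simp only [Prod.snd_one, Submodule.mem_top, true_and, Prod.mk_mul_mk, RingHom.coe_prodMap,
    Prod.map_apply]
  exact and_congr_right fun _ => ⟨fun h u v => h 0 u 0 v, fun h _ u _ v => h u v⟩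

theorem prod_isEndoPrime_iff {R₁ R₂ : Type*} [CommRing R₁] [CommRing R₂]
    (θ₁ : R₁ →+* R₁) (θ₂ : R₂ →+* R₂) (E : Ideal (R₁ × R₂)) :
    IsEndoPrime (θ₁.prodMap θ₂) E ↔
      ((∃ E₁ : Ideal R₁, IsEndoPrime θ₁ E₁ ∧ E = Ideal.prod E₁ ⊤) ∨
       (∃ E₂ : Ideal R₂, IsEndoPrime θ₂ E₂ ∧ E = Ideal.prod ⊤ E₂)) := by
  constructor
  · intro h
    obtain ⟨I, J, rfl⟩ : ∃ I J, E = Ideal.prod I J := ⟨_, _, Ideal.ideal_prod_eq E⟩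
    rcases h.2 (1, 0) (0, 1) (by simp) with h₁ | h₂
    · obtain rfl : I = ⊤ := (Ideal.eq_top_iff_one I).2 h₁.1
      exact Or.inr ⟨J, (isEndoPrime_top_prod_iff θ₁ θ₂ J).1 h, rfl⟩
    · obtain rfl : J = ⊤ := (Ideal.eq_top_iff_one J).2 (by simpa using h₂.2)
      exact Or.inl ⟨I, (isEndoPrime_prod_top_iff θ₁ θ₂ I).1 h, rfl⟩
  · rintro (⟨I, hI, rfl⟩ | ⟨J, hJ, rfl⟩)
    · exact (isEndoPrime_prod_top_iff θ₁ θ₂ I).2 hI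
    · exact (isEndoPrime_top_prod_iff θ₁ θ₂ J).2 hJ
end

section
/- Let E be a θ-primary ideal of R. Then the radical rad(E) of E is a θ-prime ideal of R. -/
/-- A proper ideal `E` of a commutative ring `R` is `θ`-primary (Endo-primary associated
with the endomorphism `θ`) if `u * v ∈ E` implies `u ∈ E` or `θ v ∈ rad E`. -/
def IsEndoPrimary {R : Type*} [CommRing R] (θ : R →+* R) (E : Ideal R) : Prop :=
  E ≠ ⊤ ∧ ∀ u v : R, u * v ∈ E → u ∈ E ∨ θ v ∈ E.radical

theorem radical_isEndoPrime_of_isEndoPrimary {R : Type*} [CommRing R] (θ : R →+* R)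
    (E : Ideal R) (hE : IsEndoPrimary θ E) : IsEndoPrime θ E.radical := by
  refine ⟨fun h => hE.1 (Ideal.radical_eq_top.mp h), fun u v ⟨n, hn⟩ => ?_⟩
  rw [mul_pow] at hn
  refine (hE.2 _ _ hn).imp (fun hu => ⟨n, hu⟩) fun hv => ?_
  rw [map_pow] at hv
  exact E.radical_isRadical ⟨n, hv⟩
end
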